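/- In the minimax setting of the context, suppose Algorithm AGM-EF-1 is applied to minimize J = f + Ψ, treating f as λ1-sc wrt d, producing sequences (x_k), (u_k), (z_k), (a_k). Set a₀ := 1 and b_k(i) := a_i ∏_{j=i+1}^{k} (1 − a_j) for 0 ≤ i ≤ k, and define the dual iterates α_k := Σ_{i=0}^{k} b_k(i) α(u_i). Then α_k ∈ Q₂, and the duality gap satisfies J(x_k) − D(α_k) ≤ (L/σ) b_k(0) sup_{x ∈ dom Ψ} Δ(x, u₀) for every k ≥ 1. -/

import Mathlib

noncomputable section

open scoped BigOperators

/-- Bregman divergence induced by `d`. -/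
def breg {E : Type*} [NormedAddCommGroup E] [NormedSpace ℝ E]
    (d : E → ℝ) (x y : E) : ℝ :=
  d x - d y - fderiv ℝ d y (x - y)

/-- `d` is `σ`-strongly convex with respect to the norm `‖·‖`. -/
def StrongConvexOnNorm {E : Type*} [NormedAddCommGroup E] [NormedSpace ℝ E]
    (σ : ℝ) (d : E → ℝ) : Prop :=
  ∀ x y : E, d x ≥ d y + fderiv ℝ d y (x - y) + σ / 2 * ‖x - y‖ ^ 2

/-- `g` is a subgradient of the extended-real-valued function `h` at `y`. -/
def IsSubgradE {E : Type*} [NormedAddCommGroup E] [NormedSpace ℝ E]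
    (h : E → EReal) (y : E) (g : E →L[ℝ] ℝ) : Prop :=
  ∀ x, h x ≥ h y + ((g (x - y) : ℝ) : EReal)

/-- `h` is `lam`-strongly convex with respect to `d` (extended-real-valued version). -/
def ScWrtE {E : Type*} [NormedAddCommGroup E] [NormedSpace ℝ E]
    (d : E → ℝ) (lam : ℝ) (h : E → EReal) : Prop :=
  ∀ y : E, h y ≠ ⊤ → ∀ g : E →L[ℝ] ℝ, IsSubgradE h y g →
    ∀ x, h x ≥ h y + ((g (x - y) + lam * breg d x y : ℝ) : EReal)

/-- `f` is `lam`-strongly convex with respect to `d` (real-valued version). -/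
def ScWrtR {E : Type*} [NormedAddCommGroup E] [NormedSpace ℝ E]
    (d : E → ℝ) (lam : ℝ) (f : E → ℝ) : Prop :=
  ∀ y : E, ∀ g : E →L[ℝ] ℝ, (∀ x, f x ≥ f y + g (x - y)) →
    ∀ x, f x ≥ f y + g (x - y) + lam * breg d x y

/-- Convexity for extended-real-valued functions. -/
def ConvexE {E : Type*} [NormedAddCommGroup E] [NormedSpace ℝ E]
    (h : E → EReal) : Prop :=
  ∀ x y : E, ∀ a b : ℝ, 0 ≤ a → 0 ≤ b → a + b = 1 →
    h (a • x + b • y) ≤ ((a : ℝ) : EReal) * h x + ((b : ℝ) : EReal) * h y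

/-- The lower model `ℓ_f(x; y, lam1)`. -/
def ellf {E : Type*} [NormedAddCommGroup E] [NormedSpace ℝ E]
    (d : E → ℝ) (f : E → ℝ) (lam1 : ℝ) (x y : E) : ℝ :=
  f y + fderiv ℝ f y (x - y) + lam1 * breg d x y


section Bregman

open Set Filter Topology

variable {E : Type*} [NormedAddCommGroup E] [NormedSpace ℝ E]

lemma breg_self (d : E → ℝ) (y : E) : breg d y y = 0 := by simp [breg]

lemma StrongConvexOnNorm.le_breg {σ : ℝ} {d : E → ℝ} (h : StrongConvexOnNorm σ d) (x y : E) :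
    σ / 2 * ‖x - y‖ ^ 2 ≤ breg d x y := by
  have := h x y
  unfold breg
  linarith

lemma StrongConvexOnNorm.breg_nonneg {σ : ℝ} {d : E → ℝ} (hσ : 0 ≤ σ)
    (h : StrongConvexOnNorm σ d) (x y : E) : 0 ≤ breg d x y :=
  le_trans (by positivity) (h.le_breg x y)

/-- First-order optimality for a local minimizer of a smooth plus convex function. -/
lemma fderiv_add_sub_nonneg_of_isLocalMinOn {S : Set E} {P G : E → ℝ} (hP : ConvexOn ℝ S P)
    {G' : E →L[ℝ] ℝ} {κ : ℝ} (hκ : 0 ≤ κ) {z : E} (hz : z ∈ S) (hG : HasFDerivAt G G' z)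
    (hmin : IsLocalMinOn (fun w => G w + κ * P w) S z) {x : E} (hx : x ∈ S) :
    0 ≤ G' (x - z) + κ * (P x - P z) := by
  have hline : HasDerivAt (fun t : ℝ => z + t • (x - z)) (x - z) 0 := by
    simpa using ((hasDerivAt_id (0 : ℝ)).smul_const (x - z)).const_add z
  have hG0 : HasFDerivAt G G' (z + (0 : ℝ) • (x - z)) := by simpa using hG
  have hder : HasDerivAt (fun t : ℝ => G (z + t • (x - z))) (G' (x - z)) 0 :=
    hG0.comp_hasDerivAt (0 : ℝ) hline
  have hslope := hder.tendsto_slope_zero_right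
  have hseg : ∀ t ∈ Ioo (0 : ℝ) 1, z + t • (x - z) = (1 - t) • z + t • x := by
    intro t _
    module
  have hIoo : ∀ᶠ t in 𝓝[>] (0 : ℝ), t ∈ Ioo (0 : ℝ) 1 := Ioo_mem_nhdsGT one_pos
  have htend : Tendsto (fun t : ℝ => z + t • (x - z)) (𝓝[>] 0) (𝓝[S] z) := by
    refine tendsto_nhdsWithin_iff.2 ⟨?_, ?_⟩
    · have := hline.continuousAt.tendsto
      simp only [zero_smul, add_zero] at this
      exact this.mono_left nhdsWithin_le_nhds
    · filter_upwards [hIoo] with t ht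
      rw [hseg t ht]
      exact hP.1 hz hx (by linarith [ht.2]) ht.1.le (by ring)
  have hev : ∀ᶠ t in 𝓝[>] (0 : ℝ),
      -(κ * (P x - P z)) ≤ t⁻¹ • (G (z + (0 + t) • (x - z)) - G (z + (0 : ℝ) • (x - z))) := by
    filter_upwards [hIoo, htend.eventually hmin] with t ht hle
    have hPt := hP.2 hz hx (by linarith [ht.2] : 0 ≤ 1 - t) ht.1.le (by ring)
    rw [← hseg t ht] at hPt
    simp only [smul_eq_mul] at hPt
    simp only [zero_add, zero_smul, add_zero, smul_eq_mul]
    rw [inv_mul_eq_div, le_div_iff₀ ht.1]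
    have hmul := mul_le_mul_of_nonneg_left hPt hκ
    linarith
  have := ge_of_tendsto hslope hev
  linarith

/-- Quadratic growth at a minimizer of `μ d + affine + κ P`, for `P` strongly convex with
respect to `d`. -/
lemma add_breg_le_of_isMinOn {d : E → ℝ} (hd : Differentiable ℝ d) {S : Set E} {P : E → ℝ}
    (hP : ConvexOn ℝ S P) {lam : ℝ}
    (hsc : ∀ y ∈ S, ∀ g : E →L[ℝ] ℝ, (∀ x ∈ S, P y + g (x - y) ≤ P x) →
      ∀ x ∈ S, P y + g (x - y) + lam * breg d x y ≤ P x)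
    {μ κ b : ℝ} {l : E →L[ℝ] ℝ} (hκ : 0 < κ) {R : E → ℝ}
    (hR : ∀ w ∈ S, R w = μ * d w + l w + b + κ * P w) {z : E} (hz : z ∈ S)
    (hmin : ∀ w ∈ S, R z ≤ R w) {x : E} (hx : x ∈ S) :
    R z + (μ + κ * lam) * breg d x z ≤ R x := by
  have hG : HasFDerivAt (fun w => μ * d w + l w + b) (μ • fderiv ℝ d z + l) z :=
    ((((hd z).hasFDerivAt).const_mul μ).add l.hasFDerivAt).add_const b
  have hloc : IsLocalMinOn (fun w => (μ * d w + l w + b) + κ * P w) S z := by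
    filter_upwards [self_mem_nhdsWithin] with w hw
    have := hmin w hw
    rwa [hR z hz, hR w hw] at this
  have hopt := fun y (hy : y ∈ S) =>
    fderiv_add_sub_nonneg_of_isLocalMinOn hP hκ.le hz hG hloc hy
  have hscz := hsc z hz (-(κ⁻¹ • (μ • fderiv ℝ d z + l))) (fun y hy => by
    have h := mul_nonneg (inv_nonneg.2 hκ.le) (hopt y hy)
    rw [mul_add, inv_mul_cancel_left₀ hκ.ne'] at h
    simp only [neg_apply, smul_apply, smul_eq_mul] at h ⊢
    linarith) x hx
  have h := mul_le_mul_of_nonneg_left hscz hκ.le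
  rw [hR z hz, hR x hx]
  simp only [neg_apply, smul_apply,
    add_apply, smul_eq_mul] at h
  have e : κ * (P z + -(κ⁻¹ * (μ * fderiv ℝ d z (x - z) + l (x - z))) + lam * breg d x z)
      = κ * P z - (μ * fderiv ℝ d z (x - z) + l (x - z)) + κ * lam * breg d x z := by
    field_simp
    ring
  rw [e, map_sub l] at h
  have hb : μ * breg d x z = μ * d x - μ * d z - μ * fderiv ℝ d z (x - z) := by
    unfold breg
    ring
  linarith

/-- The descent lemma. -/
lemma le_add_sq_of_lipschitz_fderiv {f : E → ℝ} (hf : Differentiable ℝ f) {L : ℝ}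
    (hL : ∀ x y : E, ‖fderiv ℝ f x - fderiv ℝ f y‖ ≤ L * ‖x - y‖) (x u : E) :
    f x ≤ f u + fderiv ℝ f u (x - u) + L / 2 * ‖x - u‖ ^ 2 := by
  set v := x - u with hv
  let h : ℝ → ℝ := fun t => t * fderiv ℝ f u v + L / 2 * ‖v‖ ^ 2 * t ^ 2 - f (u + t • v)
  have hder : ∀ t : ℝ, HasDerivAt h
      (fderiv ℝ f u v + L * ‖v‖ ^ 2 * t - fderiv ℝ f (u + t • v) v) t := by
    intro t
    have hline : HasDerivAt (fun t : ℝ => u + t • v) v t := by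
      simpa using ((hasDerivAt_id t).smul_const v).const_add u
    have h1 := ((hf (u + t • v)).hasFDerivAt).comp_hasDerivAt t hline
    have h2 := ((hasDerivAt_id t).mul_const (fderiv ℝ f u v)).add
      (((hasDerivAt_id t).pow 2).const_mul (L / 2 * ‖v‖ ^ 2))
    refine (h2.sub h1).congr_deriv ?_
    simp
    ring
  have hmono : MonotoneOn h (Icc 0 1) := by
    refine monotoneOn_of_deriv_nonneg (convex_Icc 0 1)
      (fun t _ => (hder t).continuousAt.continuousWithinAt)
      (fun t _ => (hder t).differentiableAt.differentiableWithinAt) ?_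
    intro t ht
    rw [interior_Icc] at ht
    rw [(hder t).deriv]
    have h1 : (fderiv ℝ f (u + t • v) - fderiv ℝ f u) v ≤ L * ‖t • v‖ * ‖v‖ :=
      (le_abs_self _).trans ((ContinuousLinearMap.le_opNorm _ _).trans
        (mul_le_mul_of_nonneg_right (by simpa using hL (u + t • v) u) (norm_nonneg v)))
    rw [norm_smul, Real.norm_of_nonneg ht.1.le, sub_apply] at h1
    nlinarith
  have := hmono (left_mem_Icc.2 zero_le_one) (right_mem_Icc.2 zero_le_one) zero_le_one
  simp only [h, zero_mul, one_smul, zero_smul, add_zero, hv, add_sub_cancel] at this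
  norm_num at this
  rw [hv, map_sub]
  linarith

/-- Jensen's inequality for the square of a norm, with three unnormalized weights. -/
lemma norm_sq_smul_add_three_le {t₁ t₂ t₃ : ℝ} (h₁ : 0 ≤ t₁) (h₂ : 0 ≤ t₂) (h₃ : 0 ≤ t₃)
    (p q r : E) :
    ‖t₁ • p + t₂ • q + t₃ • r‖ ^ 2 ≤
      (t₁ + t₂ + t₃) * (t₁ * ‖p‖ ^ 2 + t₂ * ‖q‖ ^ 2 + t₃ * ‖r‖ ^ 2) := by
  have hn : ‖t₁ • p + t₂ • q + t₃ • r‖ ≤ t₁ * ‖p‖ + t₂ * ‖q‖ + t₃ * ‖r‖ := by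
    refine (norm_add₃_le).trans (le_of_eq ?_)
    simp [norm_smul, abs_of_nonneg, h₁, h₂, h₃]
  refine (pow_le_pow_left₀ (norm_nonneg _) hn 2).trans ?_
  nlinarith [mul_nonneg (mul_nonneg h₁ h₂) (sq_nonneg (‖p‖ - ‖q‖)),
    mul_nonneg (mul_nonneg h₁ h₃) (sq_nonneg (‖p‖ - ‖r‖)),
    mul_nonneg (mul_nonneg h₂ h₃) (sq_nonneg (‖q‖ - ‖r‖))]

end Bregman

section ExtendedReal

open Set Filter Topology

variable {E : Type*} [NormedAddCommGroup E] [NormedSpace ℝ E]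

lemma ConvexE.convexOn_toReal {Ψ : E → EReal} (hbot : ∀ x, Ψ x ≠ ⊥) (h : ConvexE Ψ) :
    ConvexOn ℝ {w | Ψ w ≠ ⊤} (fun w => (Ψ w).toReal) := by
  have key : ∀ x, Ψ x ≠ ⊤ → ∀ y, Ψ y ≠ ⊤ → ∀ a b : ℝ, 0 ≤ a → 0 ≤ b → a + b = 1 →
      Ψ (a • x + b • y) ≤ ((a * (Ψ x).toReal + b * (Ψ y).toReal : ℝ) : EReal) := by
    intro x hx y hy a b ha hb hab
    have := h x y a b ha hb hab
    rwa [← EReal.coe_toReal hx (hbot x), ← EReal.coe_toReal hy (hbot y), ← EReal.coe_mul,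
      ← EReal.coe_mul, ← EReal.coe_add] at this
  have hS : ∀ x, Ψ x ≠ ⊤ → ∀ y, Ψ y ≠ ⊤ → ∀ a b : ℝ, 0 ≤ a → 0 ≤ b → a + b = 1 →
      Ψ (a • x + b • y) ≠ ⊤ := fun x hx y hy a b ha hb hab =>
    ne_top_of_le_ne_top (EReal.coe_ne_top _) (key x hx y hy a b ha hb hab)
  refine ⟨fun x hx y hy a b ha hb hab => hS x hx y hy a b ha hb hab,
    fun x hx y hy a b ha hb hab => ?_⟩
  have := key x hx y hy a b ha hb hab
  rw [← EReal.coe_toReal (hS x hx y hy a b ha hb hab) (hbot _)] at this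
  exact EReal.coe_le_coe_iff.1 this

lemma ScWrtE.toReal {d : E → ℝ} {lam : ℝ} {Ψ : E → EReal} (hbot : ∀ x, Ψ x ≠ ⊥)
    (h : ScWrtE d lam Ψ) {y : E} (hy : Ψ y ≠ ⊤) (g : E →L[ℝ] ℝ)
    (hg : ∀ x, Ψ x ≠ ⊤ → (Ψ y).toReal + g (x - y) ≤ (Ψ x).toReal) (x : E) (hx : Ψ x ≠ ⊤) :
    (Ψ y).toReal + g (x - y) + lam * breg d x y ≤ (Ψ x).toReal := by
  have hsub : IsSubgradE Ψ y g := by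
    intro w
    by_cases hw : Ψ w = ⊤
    · simp [hw]
    · rw [← EReal.coe_toReal hw (hbot w), ← EReal.coe_toReal hy (hbot y), ← EReal.coe_add]
      exact EReal.coe_le_coe_iff.2 (hg w hw)
  have := h y hy g hsub x
  rw [← EReal.coe_toReal hx (hbot x), ← EReal.coe_toReal hy (hbot y), ← EReal.coe_add] at this
  have := EReal.coe_le_coe_iff.1 this
  linarith

/-- Strong convexity along segments, including at points where the subdifferential is empty:
subgradients are found at nearby points by Bregman proximal regularization. -/
lemma ScWrtE.toReal_segment [FiniteDimensional ℝ E] {σ lam : ℝ} (hσ : 0 < σ) (hlam : 0 ≤ lam)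
    {d : E → ℝ} (hd : Differentiable ℝ d) (hdsc : StrongConvexOnNorm σ d)
    {Ψ : E → EReal} (hbot : ∀ x, Ψ x ≠ ⊥) (hlsc : LowerSemicontinuous Ψ) (hconv : ConvexE Ψ)
    (hsc : ScWrtE d lam Ψ) {x y : E} (hx : Ψ x ≠ ⊤) (hy : Ψ y ≠ ⊤) {a b : ℝ} (ha : 0 ≤ a)
    (hb : 0 ≤ b) (hab : a + b = 1) :
    (Ψ (a • x + b • y)).toReal + lam * (σ / 2) * (a * b) * ‖x - y‖ ^ 2 ≤
      a * (Ψ x).toReal + b * (Ψ y).toReal := by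
  have hP := hconv.convexOn_toReal hbot
  set m := a • x + b • y with hm
  have hmS : Ψ m ≠ ⊤ := hP.1 hx hy ha hb hab
  let K : E → ℝ := fun w => lam * (σ / 2) * (a * ‖x - w‖ ^ 2 + b * ‖y - w‖ ^ 2)
  have hKm : K m = lam * (σ / 2) * (a * b) * ‖x - y‖ ^ 2 := by
    have e1 : x - m = b • (x - y) := by
      rw [hm, show a = 1 - b by linarith]; module
    have e2 : y - m = (-a) • (x - y) := by
      rw [hm, show b = 1 - a by linarith]; module
    simp only [K, e1, e2, norm_smul, Real.norm_eq_abs, mul_pow, sq_abs, abs_neg]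
    linear_combination (lam * (σ / 2) * (a * b) * ‖x - y‖ ^ 2) * hab
  rw [← hKm]
  have hKc : Continuous K := by fun_prop
  refine le_of_forall_pos_le_add fun ε hε => ?_
  have hev : ∀ᶠ w in 𝓝 m, (((Ψ m).toReal - ε / 2 : ℝ) : EReal) < Ψ w ∧ K m - ε / 2 < K w := by
    have hlt : (((Ψ m).toReal - ε / 2 : ℝ) : EReal) < Ψ m :=
      (EReal.coe_lt_coe_iff.2 (sub_lt_self _ (half_pos hε))).trans_eq
        (EReal.coe_toReal hmS (hbot m))
    exact (hlsc m _ hlt).and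
      (hKc.continuousAt.eventually (lt_mem_nhds (sub_lt_self _ (half_pos hε))))
  obtain ⟨δ, hδ, hball⟩ := Metric.nhds_basis_closedBall.eventually_iff.1 hev
  obtain ⟨N, hN⟩ := exists_gt (ε / (σ * δ ^ 2))
  have hN0 : 0 < N := lt_trans (by positivity) hN
  have hNσ : ε / 2 < N * (σ / 2 * δ ^ 2) := by
    rw [div_lt_iff₀ (by positivity)] at hN
    linarith
  have hdc : Continuous d := hd.continuous
  have hlsc' : LowerSemicontinuous (fun w => Ψ w + ((N * breg d w m : ℝ) : EReal)) := by
    refine hlsc.add' (Continuous.lowerSemicontinuous ?_) fun w =>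
      EReal.continuousAt_add (Or.inr (EReal.coe_ne_bot _)) (Or.inr (EReal.coe_ne_top _))
    refine continuous_coe_real_ereal.comp ?_
    unfold breg
    fun_prop
  obtain ⟨p, hpball, hpmin⟩ := (hlsc'.lowerSemicontinuousOn _).exists_isMinOn
    ⟨m, Metric.mem_closedBall_self hδ.le⟩ (isCompact_closedBall m δ)
  have hpm := hpmin (Metric.mem_closedBall_self hδ.le)
  simp only [mem_ofPred_eq, breg_self, mul_zero, EReal.coe_zero, add_zero] at hpm
  have hpS : Ψ p ≠ ⊤ := by
    intro h
    rw [h, EReal.top_add_coe] at hpm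
    exact hmS (top_le_iff.1 hpm)
  have hpm' : (Ψ p).toReal + N * breg d p m ≤ (Ψ m).toReal := by
    rw [← EReal.coe_toReal hpS (hbot p), ← EReal.coe_toReal hmS (hbot m), ← EReal.coe_add] at hpm
    exact EReal.coe_le_coe_iff.1 hpm
  obtain ⟨hpΨ, hpK⟩ := hball hpball
  rw [← EReal.coe_toReal hpS (hbot p), EReal.coe_lt_coe_iff] at hpΨ
  have hpint : p ∈ Metric.ball m δ := by
    rw [mem_ball_iff_norm]
    by_contra! hge
    have h1 := hdsc.le_breg p m
    have h2 : σ / 2 * δ ^ 2 ≤ breg d p m := le_trans (by gcongr) h1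
    nlinarith [mul_le_mul_of_nonneg_left h2 hN0.le]
  have hG : HasFDerivAt (fun w => N * breg d w m) (N • (fderiv ℝ d p - fderiv ℝ d m)) p := by
    unfold breg
    refine HasFDerivAt.const_mul ?_ N
    refine ((hd p).hasFDerivAt.sub_const (d m)).sub ?_
    simpa using ((fderiv ℝ d m).hasFDerivAt (x := p)).sub_const (fderiv ℝ d m m)
  have hloc : IsLocalMinOn (fun w => N * breg d w m + 1 * (Ψ w).toReal) {w | Ψ w ≠ ⊤} p := by
    filter_upwards [self_mem_nhdsWithin,
      mem_nhdsWithin_of_mem_nhds (Metric.isOpen_ball.mem_nhds hpint)] with w hw hwb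
    have := hpmin (Metric.ball_subset_closedBall hwb)
    simp only [mem_ofPred_eq] at this
    rw [← EReal.coe_toReal hpS (hbot p), ← EReal.coe_toReal hw (hbot w), ← EReal.coe_add,
      ← EReal.coe_add, EReal.coe_le_coe_iff] at this
    linarith
  set g : E →L[ℝ] ℝ := -(N • (fderiv ℝ d p - fderiv ℝ d m)) with hg
  have hsub : ∀ w, Ψ w ≠ ⊤ → (Ψ p).toReal + g (w - p) ≤ (Ψ w).toReal := by
    intro w hw
    have := fderiv_add_sub_nonneg_of_isLocalMinOn hP zero_le_one hpS hG hloc hw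
    rw [hg, neg_apply]
    linarith
  have hscx := hsc.toReal hbot hpS g hsub x hx
  have hscy := hsc.toReal hbot hpS g hsub y hy
  have hbx := mul_le_mul_of_nonneg_left (hdsc.le_breg x p) hlam
  have hby := mul_le_mul_of_nonneg_left (hdsc.le_breg y p) hlam
  have hgm : 0 ≤ g (m - p) := by
    have h1 := hdsc.breg_nonneg hσ.le m p
    have h2 := hdsc.breg_nonneg hσ.le p m
    have h3 : g (m - p) = N * (breg d m p + breg d p m) := by
      rw [hg]
      simp only [breg, neg_apply, smul_apply,
        sub_apply, smul_eq_mul, map_sub]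
      ring
    rw [h3]
    positivity
  have hgsum : g (m - p) = a * g (x - p) + b * g (y - p) := by
    rw [← smul_eq_mul, ← smul_eq_mul, ← map_smul, ← map_smul, ← map_add]
    congr 1
    rw [hm, show a = 1 - b by linarith]; module
  have hfin : (Ψ p).toReal + g (m - p) + K p ≤ a * (Ψ x).toReal + b * (Ψ y).toReal := by
    have h1 := mul_le_mul_of_nonneg_left (show (Ψ p).toReal + g (x - p) +
      lam * (σ / 2 * ‖x - p‖ ^ 2) ≤ (Ψ x).toReal by linarith) ha
    have h2 := mul_le_mul_of_nonneg_left (show (Ψ p).toReal + g (y - p) +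
      lam * (σ / 2 * ‖y - p‖ ^ 2) ≤ (Ψ y).toReal by linarith) hb
    rw [hgsum]
    have h3 : (Ψ p).toReal = a * (Ψ p).toReal + b * (Ψ p).toReal := by
      rw [← add_mul, hab, one_mul]
    simp only [K]
    linarith
  linarith

end ExtendedReal

section Algorithm

variable {E : Type*} [NormedAddCommGroup E] [NormedSpace ℝ E]

/-- The choice of `u` and of the step size `a` lets the quadratic error of a gradient step be
absorbed by the strong convexity terms. -/
lemma mul_norm_sq_sub_le_of_step {σ L a t₁ t₂ t₃ : ℝ} (ha : 0 < a) (ha1 : a < 1) (hL : 0 < L)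
    (hσ : 0 < σ) (h₁ : 0 ≤ t₁) (h₂ : 0 ≤ t₂) (h₃ : 0 ≤ t₃)
    (hroot : σ * (t₁ + t₂ + t₃) = L * a ^ 2) {x z u z' : E}
    (hu : u = (t₁ + t₂ + t₃ - t₂ * a)⁻¹ •
      ((t₁ + t₂ + t₃ - (t₁ + t₂) * a) • x + (t₁ * a) • z)) :
    L * ‖(1 - a) • x + a • z' - u‖ ^ 2 ≤
      σ * (t₁ * ‖z' - z‖ ^ 2 + t₂ * ‖z' - u‖ ^ 2 + t₃ * ‖z' - x‖ ^ 2) := by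
  have hτ : 0 < t₁ + t₂ + t₃ := by
    have : 0 < σ * (t₁ + t₂ + t₃) := hroot ▸ by positivity
    exact pos_of_mul_pos_right this hσ.le
  have hden : 0 < t₁ + t₂ + t₃ - t₂ * a := by nlinarith
  have hu' : (t₁ + t₂ + t₃ - t₂ * a) • u =
      (t₁ + t₂ + t₃ - (t₁ + t₂) * a) • x + (t₁ * a) • z := by
    rw [hu, smul_inv_smul₀ hden.ne']
  have hvec : (t₁ + t₂ + t₃) • ((1 - a) • x + a • z' - u) =
      a • (t₁ • (z' - z) + t₂ • (z' - u) + t₃ • (z' - x)) := by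
    have e : (t₁ + t₂ + t₃) • ((1 - a) • x + a • z' - u) -
        a • (t₁ • (z' - z) + t₂ • (z' - u) + t₃ • (z' - x)) =
        ((t₁ + t₂ + t₃ - (t₁ + t₂) * a) • x + (t₁ * a) • z) -
          (t₁ + t₂ + t₃ - t₂ * a) • u := by module
    rw [← sub_eq_zero, e, hu', sub_self]
  have hn := congrArg (fun v => ‖v‖ ^ 2) hvec
  simp only [norm_smul, mul_pow, Real.norm_eq_abs, sq_abs] at hn
  have hj := norm_sq_smul_add_three_le h₁ h₂ h₃ (z' - z) (z' - u) (z' - x)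
  refine le_of_mul_le_mul_left ?_ (pow_pos hτ 2)
  calc (t₁ + t₂ + t₃) ^ 2 * (L * ‖(1 - a) • x + a • z' - u‖ ^ 2)
      = L * a ^ 2 * ‖t₁ • (z' - z) + t₂ • (z' - u) + t₃ • (z' - x)‖ ^ 2 := by
        linear_combination L * hn
    _ ≤ L * a ^ 2 * ((t₁ + t₂ + t₃) *
          (t₁ * ‖z' - z‖ ^ 2 + t₂ * ‖z' - u‖ ^ 2 + t₃ * ‖z' - x‖ ^ 2)) := by gcongr
    _ = _ := by rw [← hroot]; ring

/-- The invariants of the algorithm, over the effective domain `S` of the nonsmooth part `P`: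
the objective at `x k` is at most the minimum of `Q k`, and `Q (k + 1)` minorizes the function
whose minimizer defines `z (k + 1)`. -/
lemma agm_invariants {σ lam1 lam2 L : ℝ} (hσ : 0 < σ) (hlam1 : 0 ≤ lam1) (hlam2 : 0 ≤ lam2)
    (hL : 0 < L) {d : E → ℝ} (hd : Differentiable ℝ d) (hdsc : StrongConvexOnNorm σ d)
    {S : Set E} {P : E → ℝ} (hP : ConvexOn ℝ S P)
    (hsc : ∀ y ∈ S, ∀ g : E →L[ℝ] ℝ, (∀ x ∈ S, P y + g (x - y) ≤ P x) →
      ∀ x ∈ S, P y + g (x - y) + lam2 * breg d x y ≤ P x)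
    (hseg : ∀ x ∈ S, ∀ y ∈ S, ∀ a b : ℝ, 0 ≤ a → 0 ≤ b → a + b = 1 →
      P (a • x + b • y) + lam2 * (σ / 2) * (a * b) * ‖x - y‖ ^ 2 ≤ a * P x + b * P y)
    {f : E → ℝ} (hf : Differentiable ℝ f) (hfle : ∀ w y, ellf d f lam1 w y ≤ f w)
    (hfL : ∀ x y : E, ‖fderiv ℝ f x - fderiv ℝ f y‖ ≤ L * ‖x - y‖)
    {x z u : ℕ → E} {a c : ℕ → ℝ} {Q R : ℕ → E → ℝ} (hc0 : c 0 = L / σ + lam2)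
    (hcpos : ∀ k, 0 < c k)
    (hQ0 : ∀ w ∈ S, Q 0 w =
      L / σ * breg d w (u 0) + f (u 0) + fderiv ℝ f (u 0) (w - u 0) + P w)
    (hx0 : x 0 = z 0) (hzS : ∀ k, z k ∈ S) (hz0 : ∀ w ∈ S, Q 0 (z 0) ≤ Q 0 w)
    (ha : ∀ k, a (k + 1) ∈ Set.Ioo (0 : ℝ) 1)
    (haroot : ∀ k, σ * (1 - a (k + 1)) * (c k + lam2 * a (k + 1)) + σ * lam1 * a (k + 1)
        = L * a (k + 1) ^ 2)
    (hc : ∀ k, c (k + 1) = (1 - a (k + 1)) * c k + (lam1 + lam2) * a (k + 1))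
    (hu : ∀ k,
      u (k + 1) =
        ((((1 - a (k + 1)) * c k + lam1 * a (k + 1) + lam2 * a (k + 1) * (1 - a (k + 1)))
            - lam1 * a (k + 1) * a (k + 1))⁻¹) •
          (((((1 - a (k + 1)) * c k + lam1 * a (k + 1) + lam2 * a (k + 1) * (1 - a (k + 1)))
                - ((1 - a (k + 1)) * c k + lam1 * a (k + 1)) * a (k + 1)) • x k)
            + (((1 - a (k + 1)) * c k * a (k + 1)) • z k)))
    (hR : ∀ k, ∀ w ∈ S, R k w =
      (1 - a (k + 1)) * Q k w + a (k + 1) * (ellf d f lam1 w (u (k + 1)) + P w))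
    (hz : ∀ k, ∀ w ∈ S, R k (z (k + 1)) ≤ R k w)
    (hx : ∀ k, x (k + 1) = (1 - a (k + 1)) • x k + a (k + 1) • z (k + 1))
    (hQ : ∀ k, ∀ w ∈ S, Q (k + 1) w = c (k + 1) * breg d w (z (k + 1)) + R k (z (k + 1)))
    (k : ℕ) :
    x k ∈ S ∧ f (x k) + P (x k) ≤ Q k (z k) ∧
      (∀ w ∈ S, Q k (z k) + c k * breg d w (z k) ≤ Q k w) ∧
      ∀ w ∈ S, Q (k + 1) w ≤ R k w := by
  have hform : ∀ k, ∃ μ κ b : ℝ, ∃ l : E →L[ℝ] ℝ, 0 ≤ κ ∧ μ + κ * lam2 = c k ∧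
      ∀ w ∈ S, Q k w = μ * d w + l w + b + κ * P w := by
    intro k
    cases k with
    | zero =>
      refine ⟨L / σ, 1, -(L / σ) * (d (u 0) - fderiv ℝ d (u 0) (u 0)) + f (u 0)
        - fderiv ℝ f (u 0) (u 0), fderiv ℝ f (u 0) - (L / σ) • fderiv ℝ d (u 0),
        zero_le_one, by rw [hc0]; ring, fun w hw => ?_⟩
      rw [hQ0 w hw]
      simp only [breg, map_sub, sub_apply, smul_apply, smul_eq_mul]
      ring
    | succ k =>
      refine ⟨c (k + 1), 0, -c (k + 1) * (d (z (k + 1)) - fderiv ℝ d (z (k + 1)) (z (k + 1)))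
        + R k (z (k + 1)), -(c (k + 1) • fderiv ℝ d (z (k + 1))), le_rfl, by ring,
        fun w hw => ?_⟩
      rw [hQ k w hw]
      simp only [breg, map_sub, neg_apply, smul_apply, smul_eq_mul]
      ring
  have hRQ : ∀ k, ∀ w ∈ S, Q (k + 1) w ≤ R k w := by
    intro k w hw
    obtain ⟨μ, κ, b, l, hκ, hμ, hQk⟩ := hform k
    obtain ⟨hapos, ha1⟩ := ha k
    have hκ' : 0 < (1 - a (k + 1)) * κ + a (k + 1) := by
      have := mul_nonneg (sub_nonneg.2 ha1.le) hκ
      linarith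
    have := add_breg_le_of_isMinOn hd hP hsc hκ' (R := R k)
      (μ := (1 - a (k + 1)) * μ + a (k + 1) * lam1)
      (l := (1 - a (k + 1)) • l + a (k + 1) •
        (fderiv ℝ f (u (k + 1)) - lam1 • fderiv ℝ d (u (k + 1))))
      (b := (1 - a (k + 1)) * b + a (k + 1) * (f (u (k + 1))
        - fderiv ℝ f (u (k + 1)) (u (k + 1))
        - lam1 * (d (u (k + 1)) - fderiv ℝ d (u (k + 1)) (u (k + 1)))))
      (fun w hw => by
        rw [hR k w hw, hQk w hw]
        simp only [ellf, breg, map_sub, add_apply, sub_apply, smul_apply, smul_eq_mul]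
        ring) (hzS (k + 1)) (hz k) hw
    rw [hQ k w hw, hc k, ← hμ]
    refine le_trans (le_of_eq ?_) this
    ring
  have hgrowth : ∀ k, ∀ w ∈ S, Q k (z k) + c k * breg d w (z k) ≤ Q k w := by
    intro k w hw
    cases k with
    | zero =>
      have := add_breg_le_of_isMinOn hd hP hsc zero_lt_one (R := Q 0) (μ := L / σ)
        (l := fderiv ℝ f (u 0) - (L / σ) • fderiv ℝ d (u 0))
        (b := -(L / σ) * (d (u 0) - fderiv ℝ d (u 0) (u 0)) + f (u 0)
          - fderiv ℝ f (u 0) (u 0))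
        (fun w hw => by
          rw [hQ0 w hw]
          simp only [breg, map_sub, sub_apply, smul_apply, smul_eq_mul]
          ring) (hzS 0) hz0 hw
      rwa [hc0, ← one_mul lam2]
    | succ k =>
      rw [hQ k w hw, hQ k _ (hzS (k + 1)), breg_self]
      linarith
  suffices hmain : ∀ k, x k ∈ S ∧ f (x k) + P (x k) ≤ Q k (z k) from
    ⟨(hmain k).1, (hmain k).2, hgrowth k, hRQ k⟩
  intro k
  induction k with
  | zero =>
    rw [hx0]
    refine ⟨hzS 0, ?_⟩
    have h1 := le_add_sq_of_lipschitz_fderiv hf hfL (z 0) (u 0)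
    have h2 := mul_le_mul_of_nonneg_left (hdsc.le_breg (z 0) (u 0)) (by positivity : 0 ≤ L / σ)
    have h3 : L / σ * (σ / 2 * ‖z 0 - u 0‖ ^ 2) = L / 2 * ‖z 0 - u 0‖ ^ 2 := by
      field_simp
    rw [hQ0 _ (hzS 0)]
    linarith
  | succ k ih =>
    obtain ⟨hxk, hJ⟩ := ih
    obtain ⟨hapos, ha1⟩ := ha k
    have ha1' : 0 ≤ 1 - a (k + 1) := by linarith
    have hz' := hzS (k + 1)
    have hstep := mul_norm_sq_sub_le_of_step hapos ha1 hL hσ (z' := z (k + 1))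
      (mul_nonneg ha1' (hcpos k).le) (mul_nonneg hlam1 hapos.le)
      (mul_nonneg (mul_nonneg hlam2 hapos.le) ha1') (by rw [← haroot k]; ring) (hu k)
    rw [← hx k] at hstep
    refine ⟨by rw [hx k]; exact hP.1 hxk hz' ha1' hapos.le (by ring), ?_⟩
    rw [hQ k _ hz', breg_self, hR k _ hz']
    have hΨ := hseg _ hxk _ hz' (1 - a (k + 1)) (a (k + 1)) ha1' hapos.le (by ring)
    rw [← hx k, norm_sub_rev] at hΨ
    have hdesc := le_add_sq_of_lipschitz_fderiv hf hfL (x (k + 1)) (u (k + 1))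
    have hlow : f (u (k + 1)) + fderiv ℝ f (u (k + 1)) (x k - u (k + 1)) ≤ f (x k) := by
      have h1 := hfle (x k) (u (k + 1))
      have h2 := mul_nonneg hlam1 (hdsc.breg_nonneg hσ.le (x k) (u (k + 1)))
      unfold ellf at h1
      linarith
    have hQz := mul_le_mul_of_nonneg_left (show f (u (k + 1)) +
      fderiv ℝ f (u (k + 1)) (x k - u (k + 1)) + P (x k) +
      c k * (σ / 2 * ‖z (k + 1) - z k‖ ^ 2) ≤ Q k (z (k + 1)) by
        have h1 := hgrowth k _ hz'
        have h2 := mul_le_mul_of_nonneg_left (hdsc.le_breg (z (k + 1)) (z k)) (hcpos k).le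
        linarith) ha1'
    have hell := mul_le_mul_of_nonneg_left (show f (u (k + 1)) +
      fderiv ℝ f (u (k + 1)) (z (k + 1) - u (k + 1)) +
      lam1 * (σ / 2 * ‖z (k + 1) - u (k + 1)‖ ^ 2) ≤ ellf d f lam1 (z (k + 1)) (u (k + 1)) by
        have h2 := mul_le_mul_of_nonneg_left (hdsc.le_breg (z (k + 1)) (u (k + 1))) hlam1
        unfold ellf
        linarith) hapos.le
    have hlin : fderiv ℝ f (u (k + 1)) (x (k + 1) - u (k + 1)) =
        (1 - a (k + 1)) * fderiv ℝ f (u (k + 1)) (x k - u (k + 1)) +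
          a (k + 1) * fderiv ℝ f (u (k + 1)) (z (k + 1) - u (k + 1)) := by
      rw [← smul_eq_mul, ← smul_eq_mul, ← map_smul, ← map_smul, ← map_add, hx k]
      congr 1
      module
    linarith

end Algorithm

/-- duality-gap bound for AGM-EF-1 in the minimax setting. -/
theorem stmt18 {E : Type*} [NormedAddCommGroup E] [NormedSpace ℝ E] [FiniteDimensional ℝ E]
    {F : Type*} [NormedAddCommGroup F] [InnerProductSpace ℝ F] [FiniteDimensional ℝ F]
    (σ lam1 lam2 L : ℝ) (hσ : 0 < σ) (hlam1 : 0 ≤ lam1) (hlam2 : 0 ≤ lam2)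
    (hL : σ * lam1 < L)
    (d : E → ℝ) (hddiff : Differentiable ℝ d) (hdconv : ConvexOn ℝ Set.univ d)
    (hdsc : StrongConvexOnNorm σ d)
    (Ψ : E → EReal) (hΨbot : ∀ x, Ψ x ≠ ⊥) (hΨprop : ∃ x, Ψ x ≠ ⊤)
    (hΨlsc : LowerSemicontinuous Ψ) (hΨconv : ConvexE Ψ) (hΨsc : ScWrtE d lam2 Ψ)
    -- minimax setting
    (Q₂ : Set F) (hQne : Q₂.Nonempty) (hQcp : IsCompact Q₂) (hQcv : Convex ℝ Q₂)
    (φ : E → F → ℝ)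
    (hφcont : ContinuousOn (fun p : E × F => φ p.1 p.2) (Set.univ ×ˢ Q₂))
    (hφconv : ∀ β ∈ Q₂, ConvexOn ℝ Set.univ (fun x => φ x β))
    (hφdiff : ∀ β ∈ Q₂, Differentiable ℝ (fun x => φ x β))
    (hφsc : ∀ β ∈ Q₂, ScWrtR d lam1 (fun x => φ x β))
    (hφconc : ∀ x : E, ConcaveOn ℝ Q₂ (φ x))
    (αm : E → F) (hαmem : ∀ x, αm x ∈ Q₂)
    (hαmax : ∀ x, ∀ β ∈ Q₂, φ x β ≤ φ x (αm x))
    (hαuniq : ∀ x, ∀ β ∈ Q₂, (∀ γ ∈ Q₂, φ x γ ≤ φ x β) → β = αm x)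
    (f : E → ℝ) (hf : ∀ x, f x = φ x (αm x))
    (hfdiff : Differentiable ℝ f) (hfsc : ScWrtR d lam1 f)
    (hDanskin : ∀ x, fderiv ℝ f x = fderiv ℝ (fun y => φ y (αm x)) x)
    (hfL : ∀ x y : E, ‖fderiv ℝ f x - fderiv ℝ f y‖ ≤ L * ‖x - y‖)
    -- Algorithm AGM-EF-1
    (x z u : ℕ → E) (a c : ℕ → ℝ) (ψ q : ℕ → E → EReal)
    (hu0 : Ψ (u 0) ≠ ⊤) (hc0 : c 0 = L / σ + lam2)
    (hq0 : ∀ w, q 0 w =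
      ((L / σ * breg d w (u 0) + f (u 0) + fderiv ℝ f (u 0) (w - u 0) : ℝ) : EReal) + Ψ w)
    (hx0 : x 0 = z 0) (hz0min : ∀ w, q 0 (z 0) ≤ q 0 w)
    (hamem : ∀ k, a (k + 1) ∈ Set.Ioo (0 : ℝ) 1)
    (haroot : ∀ k, σ * (1 - a (k + 1)) * (c k + lam2 * a (k + 1)) + σ * lam1 * a (k + 1)
        = L * a (k + 1) ^ 2)
    (hc : ∀ k, c (k + 1) = (1 - a (k + 1)) * c k + (lam1 + lam2) * a (k + 1))
    (hu : ∀ k,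
      u (k + 1) =
        ((((1 - a (k + 1)) * c k + lam1 * a (k + 1) + lam2 * a (k + 1) * (1 - a (k + 1)))
            - lam1 * a (k + 1) * a (k + 1))⁻¹) •
          (((((1 - a (k + 1)) * c k + lam1 * a (k + 1) + lam2 * a (k + 1) * (1 - a (k + 1)))
                - ((1 - a (k + 1)) * c k + lam1 * a (k + 1)) * a (k + 1)) • x k)
            + (((1 - a (k + 1)) * c k * a (k + 1)) • z k)))
    (hψ : ∀ k w, ψ (k + 1) w =
      ((1 - a (k + 1) : ℝ) : EReal) * q k w
        + ((a (k + 1) : ℝ) : EReal) * (((ellf d f lam1 w (u (k + 1)) : ℝ) : EReal) + Ψ w))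
    (hz : ∀ k w, ψ (k + 1) (z (k + 1)) ≤ ψ (k + 1) w)
    (hx : ∀ k, x (k + 1) = (1 - a (k + 1)) • x k + a (k + 1) • z (k + 1))
    (hq : ∀ k w, q (k + 1) w =
      ((c (k + 1) * breg d w (z (k + 1)) : ℝ) : EReal) + ψ (k + 1) (z (k + 1)))
    -- dual iterates
    (ha0 : a 0 = 1) (αk : ℕ → F)
    (hαk : ∀ k : ℕ, αk k =
      ∑ i ∈ Finset.range (k + 1), (a i * ∏ j ∈ Finset.Icc (i + 1) k, (1 - a j)) • αm (u i)) :
    ∀ k : ℕ, 1 ≤ k →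
      αk k ∈ Q₂ ∧
      (((f (x k) : ℝ) : EReal) + Ψ (x k)) - (⨅ w : E, (((φ w (αk k) : ℝ) : EReal) + Ψ w)) ≤
        ((L / σ * (a 0 * ∏ j ∈ Finset.Icc 1 k, (1 - a j)) : ℝ) : EReal) *
          ⨆ w ∈ {w' : E | Ψ w' ≠ ⊤}, ((breg d w (u 0) : ℝ) : EReal) := by
  have hLpos : 0 < L := (mul_nonneg hσ.le hlam1).trans_lt hL
  have hPS : ∀ w, Ψ w ≠ ⊤ → Ψ w = (((Ψ w).toReal : ℝ) : EReal) := fun w hw =>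
    (EReal.coe_toReal hw (hΨbot w)).symm
  have hcpos : ∀ k, 0 < c k := by
    intro k
    induction k with
    | zero => rw [hc0]; positivity
    | succ k ih =>
      rw [hc k]
      have h1 := mul_pos (sub_pos.2 (hamem k).2) ih
      have h2 := mul_nonneg (add_nonneg hlam1 hlam2) (hamem k).1.le
      linarith
  -- the iterates stay in the effective domain, where `q` and `ψ` are real-valued
  have hψtop : ∀ k w, q k w ≠ ⊥ → Ψ w = ⊤ → ψ (k + 1) w = ⊤ := by
    intro k w hqw hw
    rw [hψ k w, hw, EReal.coe_add_top, EReal.coe_mul_top_of_pos (hamem k).1]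
    refine EReal.add_top_of_ne_bot fun h => ?_
    rcases EReal.mul_eq_bot _ _ |>.1 h with h | h | h | h
    · exact EReal.coe_ne_bot _ h.1
    · exact hqw h.2
    · exact EReal.coe_ne_top _ h.1
    · exact absurd (EReal.coe_lt_coe_iff.1 h.1) (not_lt.2 (sub_nonneg.2 (hamem k).2.le))
  have hψreal : ∀ k w, q k w ≠ ⊥ → q k w ≠ ⊤ → Ψ w ≠ ⊤ → ψ (k + 1) w =
      (((1 - a (k + 1)) * (q k w).toReal + a (k + 1) *
        (ellf d f lam1 w (u (k + 1)) + (Ψ w).toReal) : ℝ) : EReal) := by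
    intro k w h1 h2 hw
    rw [hψ k w]
    conv_lhs => rw [hPS w hw, ← EReal.coe_toReal h2 h1]
    norm_cast
  have hfin : ∀ k, (∀ w, q k w ≠ ⊥) ∧ (∀ w, Ψ w ≠ ⊤ → q k w ≠ ⊤) ∧ Ψ (z k) ≠ ⊤ := by
    intro k
    induction k with
    | zero =>
      have h2 : ∀ w, Ψ w ≠ ⊤ → q 0 w ≠ ⊤ := fun w hw => by
        rw [hq0 w]; exact EReal.add_ne_top (EReal.coe_ne_top _) hw
      refine ⟨fun w => ?_, h2, fun h => ?_⟩
      · rw [hq0 w, ne_eq, EReal.add_eq_bot_iff]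
        exact not_or.2 ⟨EReal.coe_ne_bot _, hΨbot w⟩
      · have hmin := hz0min (u 0)
        rw [hq0 (z 0), h, EReal.coe_add_top] at hmin
        exact h2 _ hu0 (top_le_iff.1 hmin)
    | succ k ih =>
      obtain ⟨hbot, htop, -⟩ := ih
      have hzS : Ψ (z (k + 1)) ≠ ⊤ := fun h => by
        have hmin := hz k (u 0)
        rw [hψtop k _ (hbot _) h, hψreal k _ (hbot _) (htop _ hu0) hu0] at hmin
        exact EReal.coe_ne_top _ (top_le_iff.1 hmin)
      have hqr : ∀ w, ∃ r : ℝ, q (k + 1) w = (r : EReal) := fun w => by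
        rw [hq k w, hψreal k _ (hbot _) (htop _ hzS) hzS]
        exact ⟨_, (EReal.coe_add _ _).symm⟩
      refine ⟨fun w => ?_, fun w _ => ?_, hzS⟩ <;> obtain ⟨r, hr⟩ := hqr w <;> simp [hr]
  have hψcoe := fun k w (hw : Ψ w ≠ ⊤) =>
    hψreal k w ((hfin k).1 w) ((hfin k).2.1 w hw) hw
  have hφell : ∀ w y, ellf d f lam1 w y ≤ φ w (αm y) := by
    intro w y
    have hmodel := hφsc _ (hαmem y) y (fderiv ℝ f y) (fun v => by
      rw [hDanskin y]
      have hconv := hφconv _ (hαmem y)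
      have hopt := fderiv_add_sub_nonneg_of_isLocalMinOn (κ := 1)
        (P := fun v => φ v (αm y)) (G := fun v => -φ v (αm y)) hconv zero_le_one
        (Set.mem_univ y) ((hφdiff _ (hαmem y) y).hasFDerivAt.neg)
        (Filter.Eventually.of_forall fun v => by simp) (Set.mem_univ v)
      simp only [neg_apply] at hopt
      linarith) w
    rw [ellf, hf y]
    linarith
  have hinv := agm_invariants (S := {w | Ψ w ≠ ⊤}) (P := fun w => (Ψ w).toReal)
    (Q := fun k w => (q k w).toReal)
    (R := fun k w => (1 - a (k + 1)) * (q k w).toReal + a (k + 1) *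
        (ellf d f lam1 w (u (k + 1)) + (Ψ w).toReal))
    hσ hlam1 hlam2 hLpos hddiff hdsc (hΨconv.convexOn_toReal hΨbot)
    (fun y hy g hg w hw => hΨsc.toReal hΨbot hy g hg w hw)
    (fun w hw y hy s t hs ht hst =>
      hΨsc.toReal_segment hσ hlam2 hddiff hdsc hΨbot hΨlsc hΨconv hw hy hs ht hst)
    hfdiff (fun w y => (hφell w y).trans ((hαmax w _ (hαmem y)).trans_eq (hf w).symm)) hfL
    hc0 hcpos
    (fun w hw => by
      have h := hq0 w
      rw [hPS w hw, ← EReal.coe_add] at h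
      simp only [h, EReal.toReal_coe])
    hx0 (fun k => (hfin k).2.2)
    (fun w hw => EReal.toReal_le_toReal (hz0min w) ((hfin 0).1 _) ((hfin 0).2.1 w hw))
    hamem haroot hc hu (fun _ _ _ => rfl)
    (fun k w hw => by
      have h := hz k w
      rw [hψcoe k w hw, hψcoe k _ (hfin (k + 1)).2.2] at h
      exact EReal.coe_le_coe_iff.1 h)
    hx
    (fun k w _ => by
      have h := hq k w
      rw [hψcoe k _ (hfin (k + 1)).2.2, ← EReal.coe_add] at h
      simp only [h, EReal.toReal_coe])
  have hαsucc : ∀ k, αk (k + 1) = (1 - a (k + 1)) • αk k + a (k + 1) • αm (u (k + 1)) := by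
    intro k
    rw [hαk (k + 1), hαk k, Finset.sum_range_succ, Finset.smul_sum]
    congr 1
    · refine Finset.sum_congr rfl fun i hi => ?_
      rw [Finset.prod_Icc_succ_top (by simp at hi; omega), smul_smul]
      congr 1
      ring
    · simp
  have hdual : ∀ k, αk k ∈ Q₂ ∧ ∀ w, Ψ w ≠ ⊤ → (q k w).toReal ≤
      L / σ * (∏ j ∈ Finset.Icc 1 k, (1 - a j)) * breg d w (u 0) + φ w (αk k)
        + (Ψ w).toReal := by
    intro k
    induction k with
    | zero =>
      have h0 : αk 0 = αm (u 0) := by simp [hαk, ha0]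
      refine ⟨h0 ▸ hαmem _, fun w hw => ?_⟩
      have hell := hφell w (u 0)
      have hnn := mul_nonneg hlam1 (hdsc.breg_nonneg hσ.le w (u 0))
      have h := hq0 w
      rw [hPS w hw, ← EReal.coe_add] at h
      rw [h, EReal.toReal_coe, h0]
      unfold ellf at hell
      rw [Finset.Icc_eq_empty (by norm_num), Finset.prod_empty]
      linarith
    | succ k ih =>
      obtain ⟨hmem, hle⟩ := ih
      obtain ⟨hapos, ha1⟩ := hamem k
      have ha1' : 0 ≤ 1 - a (k + 1) := by linarith
      refine ⟨?_, fun w hw => ?_⟩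
      · rw [hαsucc k]
        exact hQcv hmem (hαmem _) ha1' hapos.le (by ring)
      · have h1 := (hinv k).2.2.2 w hw
        have h2 := mul_le_mul_of_nonneg_left (hle w hw) ha1'
        have h3 := mul_le_mul_of_nonneg_left (hφell w (u (k + 1))) hapos.le
        have h4 := (hφconc w).2 hmem (hαmem (u (k + 1))) ha1' hapos.le (by ring)
        rw [← hαsucc k] at h4
        simp only [smul_eq_mul] at h4
        rw [Finset.prod_Icc_succ_top (by omega)]
        linarith
  intro k _
  refine ⟨(hdual k).1, ?_⟩
  obtain ⟨hxS, hJ, hgrowth, -⟩ := hinv k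
  set C : ℝ := L / σ * (a 0 * ∏ j ∈ Finset.Icc 1 k, (1 - a j)) with hC
  have hCpos : 0 < C := by
    rw [hC, ha0, one_mul]
    refine mul_pos (by positivity) (Finset.prod_pos fun j hj => ?_)
    obtain ⟨i, rfl⟩ := Nat.exists_eq_add_of_le' (Finset.mem_Icc.1 hj).1
    exact sub_pos.2 (hamem i).2
  have hgap : ∀ w, Ψ w ≠ ⊤ → f (x k) + (Ψ (x k)).toReal ≤
      C * breg d w (u 0) + (φ w (αk k) + (Ψ w).toReal) := by
    intro w hw
    have h1 := hgrowth w hw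
    have h2 := mul_nonneg (hcpos k).le (hdsc.breg_nonneg hσ.le w (z k))
    have h3 := (hdual k).2 w hw
    rw [hC, ha0, one_mul]
    linarith
  set s : EReal := ⨆ w ∈ {w' : E | Ψ w' ≠ ⊤}, ((breg d w (u 0) : ℝ) : EReal) with hs
  have hles : ∀ w, Ψ w ≠ ⊤ → ((breg d w (u 0) : ℝ) : EReal) ≤ s := fun w hw =>
    le_iSup₂ (f := fun w (_ : w ∈ {w' : E | Ψ w' ≠ ⊤}) => ((breg d w (u 0) : ℝ) : EReal)) w hw
  by_cases hs_top : s = ⊤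
  · rw [hs_top, EReal.coe_mul_top_of_pos hCpos]
    exact le_top
  have hsbot : s ≠ ⊥ := ne_bot_of_le_ne_bot (EReal.coe_ne_bot _) (hles _ hu0)
  rw [← EReal.coe_toReal hs_top hsbot, hPS _ hxS, ← EReal.coe_add, ← EReal.coe_mul]
  have hD : ((f (x k) + (Ψ (x k)).toReal - C * s.toReal : ℝ) : EReal) ≤
      ⨅ w : E, (((φ w (αk k) : ℝ) : EReal) + Ψ w) := by
    refine le_iInf fun w => ?_
    by_cases hw : Ψ w = ⊤
    · rw [hw, EReal.coe_add_top]
      exact le_top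
    rw [hPS w hw, ← EReal.coe_add, EReal.coe_le_coe_iff]
    have h1 := hles w hw
    rw [← EReal.coe_toReal hs_top hsbot, EReal.coe_le_coe_iff] at h1
    have h2 := mul_le_mul_of_nonneg_left h1 hCpos.le
    have h3 := hgap w hw
    linarith
  refine (EReal.sub_le_sub le_rfl hD).trans ?_
  rw [← EReal.coe_sub, EReal.coe_le_coe_iff]
  linarith
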